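/- Let H = S⁻ᵀDS⁻¹ and Ĥ = Ŝ⁻ᵀD̂Ŝ⁻¹ be Hamiltonian matrices with symplectic diagonalizations, with covariance matrices V := (1/2)·S·coth(D)·Sᵀ and V̂ := (1/2)·Ŝ·coth(D̂)·Ŝᵀ, and write d_max for the largest diagonal entry of D. Let t, t̂ ∈ ℝ^{2m} and ε ∈ (0,1) satisfy |V_{i,j} − V̂_{i,j}| ≤ ε and |t_i − t̂_i| ≤ ε for all i,j ∈ {1,…,2m}, and assume 2·‖V − V̂‖∞ < e^{−2 d_max}/((1 − e^{−2 d_max})·‖S‖∞²). Then Σ_{i,j∈{1,…,2m}} [(Ĥ_{i,j} − H_{i,j})·(V_{i,j} − V̂_{i,j}) + 2·(t_i − t̂_i)·(t_j − t̂_j)·(H_{i,j} + Ĥ_{i,j})] ≤ m²·ε²·(12·m·(e^{2 d_max} − 1)²·‖S‖∞⁴ + 16·‖S‖∞²·d_max). -/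

import Mathlib

open Matrix

/-- The spectral norm (ℓ²→ℓ² operator norm, largest singular value) of a matrix. -/
noncomputable def spNorm {𝕜 : Type*} [RCLike 𝕜] {p q : Type*} [Fintype p] [Fintype q]
    [DecidableEq q] (A : Matrix p q 𝕜) : ℝ :=
  ‖LinearMap.toContinuousLinearMap (Matrix.toEuclideanLin A)‖

/-- Index set for `2m × 2m` matrices: the pair `(i, δ)` stands for the index `2i - δ`,
`(i, 0)` being the first index of the `i`-th pair and `(i, 1)` the second. -/
abbrev Idx (m : ℕ) := Fin m × Fin 2

/-- The standard symplectic form: block diagonal with `m` blocks `[[0,1],[-1,0]]`. -/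
def Omega (m : ℕ) : Matrix (Idx m) (Idx m) ℝ :=
  Matrix.of fun p q =>
    if p.1 = q.1 ∧ p.2 = 0 ∧ q.2 = 1 then 1
    else if p.1 = q.1 ∧ p.2 = 1 ∧ q.2 = 0 then -1 else 0

/-- The diagonal matrix `diag (d₁, d₁, …, d_m, d_m)`. -/
def pairDiag {m : ℕ} (d : Fin m → ℝ) : Matrix (Idx m) (Idx m) ℝ :=
  Matrix.diagonal fun p => d p.1

/-- Hyperbolic cotangent. -/
noncomputable def rcoth (x : ℝ) : ℝ := Real.cosh x / Real.sinh x

/-- A real matrix regarded as a complex matrix. -/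
def cplx {p q : Type*} (A : Matrix p q ℝ) : Matrix p q ℂ :=
  A.map (fun x => (x : ℂ))

namespace St18

theorem dot_self_eq {n : Type*} [Fintype n] (x : n → ℝ) :
    x ⬝ᵥ x = ‖WithLp.toLp 2 x‖ ^ 2 := by
  rw [EuclideanSpace.norm_sq_eq]
  simp [dotProduct, sq]

theorem dot_cs {n : Type*} [Fintype n] (x y : n → ℝ) :
    (x ⬝ᵥ y) ^ 2 ≤ (x ⬝ᵥ x) * (y ⬝ᵥ y) := by
  have := Finset.sum_mul_sq_le_sq_mul_sq Finset.univ x y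
  simpa [dotProduct, sq] using this

theorem dot_self_nonneg' {n : Type*} [Fintype n] (x : n → ℝ) : 0 ≤ x ⬝ᵥ x :=
  Finset.sum_nonneg fun i _ => mul_self_nonneg (x i)

theorem spNorm_bound {n : Type*} [Fintype n] [DecidableEq n] (A : Matrix n n ℝ) (x : n → ℝ) :
    (A *ᵥ x) ⬝ᵥ (A *ᵥ x) ≤ spNorm A ^ 2 * (x ⬝ᵥ x) := by
  rw [dot_self_eq, dot_self_eq, ← mul_pow]
  have h := (LinearMap.toContinuousLinearMap (Matrix.toEuclideanLin A)).le_opNorm (WithLp.toLp 2 x)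
  refine pow_le_pow_left₀ (norm_nonneg _) ?_ 2
  exact h

theorem spNorm_nonneg {n : Type*} [Fintype n] [DecidableEq n] (A : Matrix n n ℝ) :
    0 ≤ spNorm A := norm_nonneg _

theorem spNorm_quad {n : Type*} [Fintype n] [DecidableEq n] (A : Matrix n n ℝ) (x : n → ℝ) :
    x ⬝ᵥ (A *ᵥ x) ≤ spNorm A * (x ⬝ᵥ x) := by
  have h1 := dot_cs x (A *ᵥ x)
  have h2 := spNorm_bound A x
  have h3 := dot_self_nonneg' x
  have h4 := spNorm_nonneg A
  refine abs_le_of_sq_le_sq' ?_ (mul_nonneg h4 h3) |>.2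
  nlinarith [mul_le_mul_of_nonneg_left h2 h3]

theorem transpose_bound {n : Type*} [Fintype n] [DecidableEq n] (A : Matrix n n ℝ) (σ : ℝ)
    (h : ∀ x, (A *ᵥ x) ⬝ᵥ (A *ᵥ x) ≤ σ ^ 2 * (x ⬝ᵥ x)) (x : n → ℝ) :
    (Aᵀ *ᵥ x) ⬝ᵥ (Aᵀ *ᵥ x) ≤ σ ^ 2 * (x ⬝ᵥ x) := by
  have h1 := dot_cs x (A *ᵥ (Aᵀ *ᵥ x))
  have h2 := h (Aᵀ *ᵥ x)
  have h3 := dot_self_nonneg' x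
  have h4 := dot_self_nonneg' (Aᵀ *ᵥ x)
  have h5 : x ⬝ᵥ (A *ᵥ (Aᵀ *ᵥ x)) = (Aᵀ *ᵥ x) ⬝ᵥ (Aᵀ *ᵥ x) := by
    rw [Matrix.dotProduct_mulVec, ← Matrix.mulVec_transpose]
  rw [h5] at h1
  set N := (Aᵀ *ᵥ x) ⬝ᵥ (Aᵀ *ᵥ x)
  rcases h4.eq_or_lt with h0 | h0
  · rw [← h0]; positivity
  · have : N * N ≤ (σ ^ 2 * (x ⬝ᵥ x)) * N := by
      nlinarith [mul_le_mul_of_nonneg_left h2 h3]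
    exact le_of_mul_le_mul_right this h0

/-! Omega -/

theorem Omega_mulVec {m : ℕ} (x : Idx m → ℝ) (p : Idx m) :
    (Omega m *ᵥ x) p = if p.2 = 0 then x (p.1, 1) else - x (p.1, 0) := by
  obtain ⟨i, j⟩ := p
  simp only [Matrix.mulVec, dotProduct, Omega, Matrix.of_apply, Fintype.sum_prod_type, Fin.sum_univ_two]
  fin_cases j <;> simp

theorem Omega_norm {m : ℕ} (x : Idx m → ℝ) :
    (Omega m *ᵥ x) ⬝ᵥ (Omega m *ᵥ x) = x ⬝ᵥ x := by
  simp only [dotProduct, Omega_mulVec, Fintype.sum_prod_type, Fin.sum_univ_two]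
  refine Finset.sum_congr rfl fun i _ => ?_
  simp; ring

theorem Omega_sq {m : ℕ} : Omega m * Omega m = -1 := by
  apply Matrix.ext_of_mulVec_single
  intro p
  ext q
  rw [← Matrix.mulVec_mulVec, Omega_mulVec, Omega_mulVec, Omega_mulVec]
  obtain ⟨i, j⟩ := q
  rw [Matrix.neg_mulVec, Matrix.one_mulVec]
  fin_cases j <;> simp

theorem Omega_transpose {m : ℕ} : (Omega m)ᵀ = - Omega m := by
  ext ⟨i, j⟩ ⟨k, l⟩
  fin_cases j <;> fin_cases l <;> simp [Omega, eq_comm] <;> split_ifs <;> simp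

theorem Omega_comm {m : ℕ} (d : Fin m → ℝ) : Omega m * pairDiag d = pairDiag d * Omega m := by
  ext ⟨i, j⟩ ⟨k, l⟩
  simp only [pairDiag, Matrix.mul_diagonal, Matrix.diagonal_mul, Omega, Matrix.of_apply]
  by_cases h : i = k
  · subst h; ring
  · simp [h]

theorem pairDiag_mul {m : ℕ} (a b : Fin m → ℝ) :
    pairDiag a * pairDiag b = pairDiag (fun i => a i * b i) := by
  simp [pairDiag, Matrix.diagonal_mul_diagonal]

theorem pairDiag_one {m : ℕ} : pairDiag (fun _ : Fin m => (1:ℝ)) = 1 := by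
  simp [pairDiag]

theorem pairDiag_transpose {m : ℕ} (a : Fin m → ℝ) : (pairDiag a)ᵀ = pairDiag a := by
  simp [pairDiag]

theorem pairDiag_smul {m : ℕ} (s : ℝ) (a : Fin m → ℝ) :
    s • pairDiag a = pairDiag (fun i => s * a i) := by
  ext p q
  by_cases h : p = q
  · subst h; simp [pairDiag]
  · simp [pairDiag, h]

/-- S is invertible, and the inverse transpose is `-Ω S Ω`. -/
theorem symp_inv {m : ℕ} {S : Matrix (Idx m) (Idx m) ℝ} (hS : S * Omega m * Sᵀ = Omega m) :
    S * S⁻¹ = 1 ∧ S⁻¹ * S = 1 ∧ (S⁻¹)ᵀ = - (Omega m * S * Omega m) := by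
  have h1 : S * (-(Omega m * Sᵀ * Omega m)) = 1 := by
    rw [mul_neg, ← mul_assoc, ← mul_assoc, hS, Omega_sq, neg_neg]
  have h2 : S⁻¹ = -(Omega m * Sᵀ * Omega m) := Matrix.inv_eq_right_inv h1
  refine ⟨by rw [h2, h1], by rw [h2]; exact mul_eq_one_comm.mp h1, ?_⟩
  rw [h2]
  simp [Matrix.transpose_mul, Omega_transpose, mul_assoc]

theorem symp_bound {m : ℕ} {S : Matrix (Idx m) (Idx m) ℝ} (hS : S * Omega m * Sᵀ = Omega m)
    (x : Idx m → ℝ) :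
    ((S⁻¹)ᵀ *ᵥ x) ⬝ᵥ ((S⁻¹)ᵀ *ᵥ x) ≤ spNorm S ^ 2 * (x ⬝ᵥ x) := by
  rw [(symp_inv hS).2.2, Matrix.neg_mulVec, neg_dotProduct_neg, ← Matrix.mulVec_mulVec,
    ← Matrix.mulVec_mulVec, Omega_norm]
  refine (spNorm_bound _ _).trans ?_
  rw [Omega_norm]

theorem symp_bound' {m : ℕ} {S : Matrix (Idx m) (Idx m) ℝ} (hS : S * Omega m * Sᵀ = Omega m)
    (x : Idx m → ℝ) :
    (S⁻¹ *ᵥ x) ⬝ᵥ (S⁻¹ *ᵥ x) ≤ spNorm S ^ 2 * (x ⬝ᵥ x) := by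
  have := transpose_bound _ _ (symp_bound hS) x
  simpa using this

/-- The resolvent pieces -/
noncomputable def GG {m : ℕ} (S : Matrix (Idx m) (Idx m) ℝ) (c : Fin m → ℝ) (s : ℝ) :
    Matrix (Idx m) (Idx m) ℝ :=
  (S⁻¹)ᵀ * pairDiag (fun i => c i / (c i ^ 2 - s ^ 2)) * S⁻¹

noncomputable def KK {m : ℕ} (S : Matrix (Idx m) (Idx m) ℝ) (c : Fin m → ℝ) (s : ℝ) :
    Matrix (Idx m) (Idx m) ℝ :=
  (S⁻¹)ᵀ * (Omega m * pairDiag (fun i => s / (c i ^ 2 - s ^ 2))) * S⁻¹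

theorem GG_transpose {m : ℕ} (S : Matrix (Idx m) (Idx m) ℝ) (c : Fin m → ℝ) (s : ℝ) :
    (GG S c s)ᵀ = GG S c s := by
  simp [GG, Matrix.transpose_mul, pairDiag_transpose, mul_assoc]

theorem KK_transpose {m : ℕ} (S : Matrix (Idx m) (Idx m) ℝ) (c : Fin m → ℝ) (s : ℝ) :
    (KK S c s)ᵀ = - KK S c s := by
  simp only [KK, Matrix.transpose_mul, pairDiag_transpose, Omega_transpose,
    Matrix.transpose_transpose]
  rw [Omega_comm]
  simp [mul_assoc]

theorem res1 {m : ℕ} {S : Matrix (Idx m) (Idx m) ℝ} (hS : S * Omega m * Sᵀ = Omega m)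
    (c : Fin m → ℝ) (s : ℝ) (hc : ∀ i, c i ^ 2 - s ^ 2 ≠ 0) :
    (S * pairDiag c * Sᵀ) * GG S c s + s • (Omega m * KK S c s) = 1 := by
  obtain ⟨h1, h2, h3⟩ := symp_inv hS
  have ht : Sᵀ * (S⁻¹)ᵀ = 1 := by rw [← Matrix.transpose_mul, h2, Matrix.transpose_one]
  have hO : Omega m * (S⁻¹)ᵀ = S * Omega m := by
    rw [h3, mul_neg, ← mul_assoc, ← mul_assoc, Omega_sq]; simp
  have e1 : (S * pairDiag c * Sᵀ) * GG S c s
      = S * (pairDiag c * pairDiag (fun i => c i / (c i ^ 2 - s ^ 2))) * S⁻¹ := by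
    calc _ = S * pairDiag c * (Sᵀ * (S⁻¹)ᵀ) * pairDiag (fun i => c i / (c i ^ 2 - s ^ 2)) * S⁻¹ := by
          simp only [GG, mul_assoc]
      _ = _ := by rw [ht]; simp only [mul_assoc, one_mul]
  have e2 : Omega m * KK S c s = S * (- pairDiag (fun i => s / (c i ^ 2 - s ^ 2))) * S⁻¹ := by
    calc _ = (Omega m * (S⁻¹)ᵀ) * Omega m * pairDiag (fun i => s / (c i ^ 2 - s ^ 2)) * S⁻¹ := by
          simp only [KK, mul_assoc]
      _ = S * (Omega m * Omega m) * pairDiag (fun i => s / (c i ^ 2 - s ^ 2)) * S⁻¹ := by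
          rw [hO]; simp only [mul_assoc]
      _ = _ := by rw [Omega_sq]; simp
  rw [e1, e2, ← smul_mul_assoc, ← mul_smul_comm, ← add_mul, ← mul_add, smul_neg, pairDiag_smul,
    pairDiag_mul]
  have : pairDiag (fun i => c i * (c i / (c i ^ 2 - s ^ 2))) +
      -pairDiag (fun i => s * (s / (c i ^ 2 - s ^ 2))) = 1 := by
    rw [← sub_eq_add_neg, pairDiag, pairDiag, Matrix.diagonal_sub, ← Matrix.diagonal_one]
    congr 1; ext p
    have := hc p.1
    field_simp
  rw [this, mul_one, h1]

theorem res2 {m : ℕ} {S : Matrix (Idx m) (Idx m) ℝ} (hS : S * Omega m * Sᵀ = Omega m)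
    (c : Fin m → ℝ) (s : ℝ) :
    (S * pairDiag c * Sᵀ) * KK S c s = s • (Omega m * GG S c s) := by
  obtain ⟨h1, h2, h3⟩ := symp_inv hS
  have ht : Sᵀ * (S⁻¹)ᵀ = 1 := by rw [← Matrix.transpose_mul, h2, Matrix.transpose_one]
  have hO : Omega m * (S⁻¹)ᵀ = S * Omega m := by
    rw [h3, mul_neg, ← mul_assoc, ← mul_assoc, Omega_sq]; simp
  have e1 : (S * pairDiag c * Sᵀ) * KK S c s
      = S * Omega m * (pairDiag c * pairDiag (fun i => s / (c i ^ 2 - s ^ 2))) * S⁻¹ := by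
    calc _ = S * pairDiag c * (Sᵀ * (S⁻¹)ᵀ) * Omega m * pairDiag (fun i => s / (c i ^ 2 - s ^ 2)) * S⁻¹ := by
          simp only [KK, mul_assoc]
      _ = S * (pairDiag c * Omega m) * pairDiag (fun i => s / (c i ^ 2 - s ^ 2)) * S⁻¹ := by
          rw [ht]; simp only [mul_assoc, one_mul]
      _ = _ := by rw [← Omega_comm]; simp only [mul_assoc]
  have e2 : Omega m * GG S c s = S * Omega m * pairDiag (fun i => c i / (c i ^ 2 - s ^ 2)) * S⁻¹ := by
    rw [← hO]; simp only [GG, mul_assoc]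
  rw [e1, e2, ← smul_mul_assoc, ← mul_smul_comm, pairDiag_smul, pairDiag_mul]
  congr 3
  ext i; ring

theorem W_transpose {m : ℕ} (S : Matrix (Idx m) (Idx m) ℝ) (c : Fin m → ℝ) :
    (S * pairDiag c * Sᵀ)ᵀ = S * pairDiag c * Sᵀ := by
  simp [Matrix.transpose_mul, pairDiag_transpose, mul_assoc]

theorem res1' {m : ℕ} {S : Matrix (Idx m) (Idx m) ℝ} (hS : S * Omega m * Sᵀ = Omega m)
    (c : Fin m → ℝ) (s : ℝ) (hc : ∀ i, c i ^ 2 - s ^ 2 ≠ 0) :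
    GG S c s * (S * pairDiag c * Sᵀ) + s • (KK S c s * Omega m) = 1 := by
  have := congrArg Matrix.transpose (res1 hS c s hc)
  rw [Matrix.transpose_add, Matrix.transpose_mul, W_transpose, Matrix.transpose_smul,
    Matrix.transpose_mul, GG_transpose, KK_transpose, Omega_transpose, neg_mul_neg,
    Matrix.transpose_one] at this
  exact this

theorem res2' {m : ℕ} {S : Matrix (Idx m) (Idx m) ℝ} (hS : S * Omega m * Sᵀ = Omega m)
    (c : Fin m → ℝ) (s : ℝ) :
    KK S c s * (S * pairDiag c * Sᵀ) = s • (GG S c s * Omega m) := by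
  have := congrArg Matrix.transpose (res2 hS c s)
  rw [Matrix.transpose_mul, W_transpose, Matrix.transpose_smul,
    Matrix.transpose_mul, GG_transpose, KK_transpose, Omega_transpose, neg_mul, mul_neg, smul_neg,
    neg_inj] at this
  exact this

/-- resolvent identity -/
theorem res_diff {n : Type*} [Fintype n] [DecidableEq n] (W What G K Gh Kh O : Matrix n n ℝ) (s : ℝ)
    (h1 : W * G + s • (O * K) = 1) (h2 : W * K = s • (O * G))
    (h1' : Gh * What + s • (Kh * O) = 1) (h2' : Kh * What = s • (Gh * O)) :
    Gh - G = Gh * (W - What) * G - Kh * (W - What) * K := by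
  have a : Gh = Gh * (W * G + s • (O * K)) := by rw [h1, mul_one]
  have b : G = (Gh * What + s • (Kh * O)) * G := by rw [h1', one_mul]
  have e1 : Kh * W * K = s • (Kh * O * G) := by rw [mul_assoc, h2, mul_smul_comm, mul_assoc]
  have e2 : Kh * What * K = s • (Gh * O * K) := by rw [h2', smul_mul_assoc]
  calc Gh - G = Gh * (W * G + s • (O * K)) - (Gh * What + s • (Kh * O)) * G := by rw [← a, ← b]
    _ = Gh * W * G + s • (Gh * O * K) - (Gh * What * G + s • (Kh * O * G)) := by
        simp only [mul_add, add_mul, mul_smul_comm, smul_mul_assoc, mul_assoc]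
    _ = _ := by
        rw [← e1, ← e2]; noncomm_ring

/-- coercivity implies resolvent vector bound -/
theorem res_bound {n : Type*} [Fintype n] [DecidableEq n] (W G K O : Matrix n n ℝ) (s k : ℝ)
    (hO : Oᵀ = -O) (hk : 0 < k)
    (h1 : W * G + s • (O * K) = 1) (h2 : W * K = s • (O * G))
    (hco : ∀ u v : n → ℝ, k * (u ⬝ᵥ u + v ⬝ᵥ v) ≤
      u ⬝ᵥ (W *ᵥ u) + v ⬝ᵥ (W *ᵥ v) + 2 * s * (u ⬝ᵥ (O *ᵥ v)))
    (x : n → ℝ) :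
    k ^ 2 * ((G *ᵥ x) ⬝ᵥ (G *ᵥ x) + (K *ᵥ x) ⬝ᵥ (K *ᵥ x)) ≤ x ⬝ᵥ x := by
  have h := hco (G *ᵥ x) (K *ᵥ x)
  have e1 : W *ᵥ (G *ᵥ x) = x - s • (O *ᵥ (K *ᵥ x)) := by
    have := congrArg (fun A => A *ᵥ x) h1
    simp only [Matrix.add_mulVec, Matrix.smul_mulVec, Matrix.one_mulVec, ← Matrix.mulVec_mulVec] at this
    exact eq_sub_of_add_eq this
  have e2 : W *ᵥ (K *ᵥ x) = s • (O *ᵥ (G *ᵥ x)) := by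
    have := congrArg (fun A => A *ᵥ x) h2
    simpa only [Matrix.smul_mulVec, ← Matrix.mulVec_mulVec] using this
  have e3 : (K *ᵥ x) ⬝ᵥ (O *ᵥ (G *ᵥ x)) = - ((G *ᵥ x) ⬝ᵥ (O *ᵥ (K *ᵥ x))) := by
    rw [Matrix.dotProduct_mulVec, ← Matrix.mulVec_transpose, hO, Matrix.neg_mulVec, neg_dotProduct,
      dotProduct_comm]
  rw [e1, e2, dotProduct_sub, dotProduct_smul, dotProduct_smul, e3] at h
  simp only [smul_eq_mul] at h
  have hcs := dot_cs (G *ᵥ x) x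
  have n1 := dot_self_nonneg' (G *ᵥ x)
  have n2 := dot_self_nonneg' (K *ᵥ x)
  have n3 := dot_self_nonneg' x
  set N := (G *ᵥ x) ⬝ᵥ (G *ᵥ x) + (K *ᵥ x) ⬝ᵥ (K *ᵥ x) with hN
  have h' : k * N ≤ (G *ᵥ x) ⬝ᵥ x := by linarith
  have hN0 : 0 ≤ N := by positivity
  rcases hN0.eq_or_lt with h0 | h0
  · rw [← h0]; simpa using n3
  · have a1 : (k * N) ^ 2 ≤ ((G *ᵥ x) ⬝ᵥ x) ^ 2 := pow_le_pow_left₀ (by positivity) h' 2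
    have a2 : (k ^ 2 * N) * N ≤ (x ⬝ᵥ x) * N := by
      nlinarith [mul_nonneg n2 n3]
    exact le_of_mul_le_mul_right a2 h0

end St18

namespace St18

theorem coer {m : ℕ} {S : Matrix (Idx m) (Idx m) ℝ} (hS : S * Omega m * Sᵀ = Omega m)
    (hσ : 0 < spNorm S) (c : Fin m → ℝ) (c0 s : ℝ) (hc0 : 1 < c0) (hc : ∀ i, c0 ≤ c i)
    (hs0 : 0 ≤ s) (hs1 : s ≤ 1) (u v : Idx m → ℝ) :
    (c0 - 1) / spNorm S ^ 2 * (u ⬝ᵥ u + v ⬝ᵥ v) ≤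
      u ⬝ᵥ ((S * pairDiag c * Sᵀ) *ᵥ u) + v ⬝ᵥ ((S * pairDiag c * Sᵀ) *ᵥ v)
        + 2 * s * (u ⬝ᵥ (Omega m *ᵥ v)) := by
  have key : ∀ w : Idx m → ℝ, w ⬝ᵥ w ≤ spNorm S ^ 2 * ((Sᵀ *ᵥ w) ⬝ᵥ (Sᵀ *ᵥ w)) := by
    intro w
    have h := symp_bound hS (Sᵀ *ᵥ w)
    rwa [Matrix.mulVec_mulVec, ← Matrix.transpose_mul, (symp_inv hS).1, Matrix.transpose_one,
      Matrix.one_mulVec] at h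
  have bil : ∀ (A : Matrix (Idx m) (Idx m) ℝ) (x y : Idx m → ℝ),
      x ⬝ᵥ ((S * A * Sᵀ) *ᵥ y) = (Sᵀ *ᵥ x) ⬝ᵥ (A *ᵥ (Sᵀ *ᵥ y)) := by
    intro A x y
    rw [← Matrix.mulVec_mulVec, ← Matrix.mulVec_mulVec, Matrix.dotProduct_mulVec,
      ← Matrix.mulVec_transpose]
  have hW : ∀ w : Idx m → ℝ, c0 * ((Sᵀ *ᵥ w) ⬝ᵥ (Sᵀ *ᵥ w)) ≤
      w ⬝ᵥ ((S * pairDiag c * Sᵀ) *ᵥ w) := by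
    intro w
    rw [bil]
    simp only [pairDiag, dotProduct, Matrix.mulVec_diagonal, Finset.mul_sum]
    refine Finset.sum_le_sum fun p _ => ?_
    nlinarith [hc p.1, mul_self_nonneg ((Sᵀ *ᵥ w) p)]
  have hO : u ⬝ᵥ (Omega m *ᵥ v) = (Sᵀ *ᵥ u) ⬝ᵥ (Omega m *ᵥ (Sᵀ *ᵥ v)) := by
    rw [← bil, hS]
  have hu := key u
  have hv := key v
  have hWu := hW u
  have hWv := hW v
  rw [hO]
  set a := Sᵀ *ᵥ u
  set b := Sᵀ *ᵥ v
  have hsq := dot_self_nonneg' (a + Omega m *ᵥ b)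
  rw [add_dotProduct, dotProduct_add, dotProduct_add, Omega_norm,
    dotProduct_comm (Omega m *ᵥ b) a] at hsq
  have na := dot_self_nonneg' a
  have nb := dot_self_nonneg' b
  have h1 : (c0 - 1) / spNorm S ^ 2 * (u ⬝ᵥ u + v ⬝ᵥ v) ≤ (c0 - 1) * (a ⬝ᵥ a + b ⬝ᵥ b) := by
    rw [div_mul_eq_mul_div, div_le_iff₀ (by positivity), mul_assoc]
    refine mul_le_mul_of_nonneg_left ?_ (by linarith)
    linarith
  nlinarith [mul_nonneg hs0 hsq, mul_nonneg (sub_nonneg.2 hs1) (add_nonneg na nb)]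

theorem bilin_le {n : Type*} [Fintype n] (E : Matrix n n ℝ) (η : ℝ)
    (hE : ∀ p q, |E p q| ≤ η) (a b : n → ℝ) :
    a ⬝ᵥ (E *ᵥ b) ≤ η * Fintype.card n * ((a ⬝ᵥ a) / 4 + b ⬝ᵥ b) := by
  have h : a ⬝ᵥ (E *ᵥ b) ≤ ∑ p : n, ∑ q : n, η * (a p * a p / 4 + b q * b q) := by
    simp only [dotProduct, Matrix.mulVec, Finset.mul_sum]
    refine Finset.sum_le_sum fun p _ => Finset.sum_le_sum fun q _ => ?_
    have h1 : a p * (E p q * b q) ≤ |E p q| * |a p * b q| := by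
      rw [← abs_mul]
      calc _ = E p q * (a p * b q) := by ring
        _ ≤ _ := le_abs_self _
    have h2 : |a p * b q| ≤ a p * a p / 4 + b q * b q := by
      rw [abs_le]; constructor <;> nlinarith [sq_nonneg (a p / 2 + b q), sq_nonneg (a p / 2 - b q)]
    exact h1.trans (mul_le_mul (hE p q) h2 (abs_nonneg _) ((abs_nonneg _).trans (hE p q)))
  refine h.trans (le_of_eq ?_)
  simp only [← Finset.mul_sum, Finset.sum_add_distrib, Finset.sum_const, dotProduct,
    Finset.card_univ, nsmul_eq_mul, ← Finset.sum_div]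
  ring

theorem pw_quad {n : Type*} [Fintype n] [DecidableEq n] (G K Gh Kh E : Matrix n n ℝ) (η ρ : ℝ)
    (hη : 0 ≤ η)
    (hE : ∀ p q, |E p q| ≤ η) (hGh : Ghᵀ = Gh) (hKh : Khᵀ = -Kh)
    (hd : Gh - G = Gh * E * G - Kh * E * K)
    (h1 : ∀ x, (G *ᵥ x) ⬝ᵥ (G *ᵥ x) + (K *ᵥ x) ⬝ᵥ (K *ᵥ x) ≤ ρ * (x ⬝ᵥ x))
    (h2 : ∀ x, (Gh *ᵥ x) ⬝ᵥ (Gh *ᵥ x) + (Kh *ᵥ x) ⬝ᵥ (Kh *ᵥ x) ≤ 4 * ρ * (x ⬝ᵥ x))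
    (τ : n → ℝ) :
    τ ⬝ᵥ ((Gh - G) *ᵥ τ) ≤ η * Fintype.card n * (2 * ρ * (τ ⬝ᵥ τ)) := by
  have e1 : τ ⬝ᵥ ((Gh * E * G) *ᵥ τ) = (Gh *ᵥ τ) ⬝ᵥ (E *ᵥ (G *ᵥ τ)) := by
    rw [← Matrix.mulVec_mulVec, ← Matrix.mulVec_mulVec, Matrix.dotProduct_mulVec,
      ← Matrix.mulVec_transpose, hGh]
  have e2 : τ ⬝ᵥ ((Kh * E * K) *ᵥ τ) = - ((Kh *ᵥ τ) ⬝ᵥ (E *ᵥ (K *ᵥ τ))) := by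
    rw [← Matrix.mulVec_mulVec, ← Matrix.mulVec_mulVec, Matrix.dotProduct_mulVec,
      ← Matrix.mulVec_transpose, hKh, Matrix.neg_mulVec, neg_dotProduct]
  rw [hd, Matrix.sub_mulVec, dotProduct_sub, e1, e2]
  have b1 := bilin_le E η hE (Gh *ᵥ τ) (G *ᵥ τ)
  have b2 := bilin_le E η hE (Kh *ᵥ τ) (K *ᵥ τ)
  have hN : 0 ≤ η * (Fintype.card n : ℝ) := by positivity
  have := h1 τ
  have := h2 τ
  have h3 : ((Gh *ᵥ τ) ⬝ᵥ (Gh *ᵥ τ)) / 4 + (G *ᵥ τ) ⬝ᵥ (G *ᵥ τ) +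
    (((Kh *ᵥ τ) ⬝ᵥ (Kh *ᵥ τ)) / 4 + (K *ᵥ τ) ⬝ᵥ (K *ᵥ τ)) ≤ 2 * ρ * (τ ⬝ᵥ τ) := by linarith
  have := mul_le_mul_of_nonneg_left h3 hN
  linarith

theorem pw_trace {n : Type*} [Fintype n] [DecidableEq n] (G K Gh Kh E : Matrix n n ℝ) (η ρ : ℝ)
    (hρ : 0 ≤ ρ)
    (hE : ∀ p q, |E p q| ≤ η) (hEs : Eᵀ = E)
    (hd : Gh - G = Gh * E * G - Kh * E * K)
    (h1 : ∀ x, (G *ᵥ x) ⬝ᵥ (G *ᵥ x) + (K *ᵥ x) ⬝ᵥ (K *ᵥ x) ≤ ρ * (x ⬝ᵥ x))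
    (h2 : ∀ x, (Gh *ᵥ x) ⬝ᵥ (Gh *ᵥ x) + (Kh *ᵥ x) ⬝ᵥ (Kh *ᵥ x) ≤ 4 * ρ * (x ⬝ᵥ x)) :
    ∑ p, ∑ q, (Gh - G) p q * E p q ≤ 2 * ρ * ((Fintype.card n : ℝ) ^ 2 * η ^ 2) := by
  have e0 : ∑ p, ∑ q, (Gh - G) p q * E p q =
      Matrix.trace ((Gh * E) * (G * E)) - Matrix.trace ((Kh * E) * (K * E)) := by
    have : ∑ p, ∑ q, (Gh - G) p q * E p q = Matrix.trace ((Gh - G) * E) := by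
      simp only [Matrix.trace, Matrix.diag, Matrix.mul_apply]
      refine Finset.sum_congr rfl fun p _ => Finset.sum_congr rfl fun q _ => ?_
      rw [← hEs, Matrix.transpose_apply, hEs]
    rw [this, hd, sub_mul, Matrix.trace_sub]
    simp only [mul_assoc]
  have cl : ∀ A : Matrix n n ℝ, ∑ p, ∑ q, (A * E) p q ^ 2 =
      ∑ q, (A *ᵥ (fun r => E r q)) ⬝ᵥ (A *ᵥ (fun r => E r q)) := by
    intro A
    rw [Finset.sum_comm]
    simp only [dotProduct, Matrix.mulVec, Matrix.mul_apply, sq]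
  have tr1 : ∀ A B : Matrix n n ℝ, |Matrix.trace (A * B)| ≤
      (∑ p, ∑ q, A p q ^ 2) / 4 + ∑ p, ∑ q, B p q ^ 2 := by
    intro A B
    have : (∑ p, ∑ q, A p q ^ 2) / 4 + ∑ p, ∑ q, B p q ^ 2 =
        ∑ p, ∑ q, (A p q ^ 2 / 4 + B q p ^ 2) := by
      simp only [Finset.sum_add_distrib, ← Finset.sum_div]
      congr 1
      exact Finset.sum_comm
    rw [this]
    simp only [Matrix.trace, Matrix.diag, Matrix.mul_apply]
    refine (Finset.abs_sum_le_sum_abs _ _).trans (Finset.sum_le_sum fun p _ => ?_)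
    refine (Finset.abs_sum_le_sum_abs _ _).trans (Finset.sum_le_sum fun q _ => ?_)
    rw [abs_le]; constructor <;> nlinarith [sq_nonneg (A p q / 2 + B q p), sq_nonneg (A p q / 2 - B q p)]
  have t1 := (abs_le.1 (tr1 (Gh * E) (G * E))).2
  have t2 := (abs_le.1 (tr1 (Kh * E) (K * E))).1
  rw [cl, cl] at t1 t2
  have s1 := Finset.sum_le_sum fun q (_ : q ∈ Finset.univ) => h1 (fun r => E r q)
  have s2 := Finset.sum_le_sum fun q (_ : q ∈ Finset.univ) => h2 (fun r => E r q)
  rw [Finset.sum_add_distrib, ← Finset.mul_sum] at s1 s2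
  have s3 : ∑ q, (fun r => E r q) ⬝ᵥ (fun r => E r q) ≤ (Fintype.card n : ℝ) ^ 2 * η ^ 2 := by
    calc _ ≤ ∑ _q : n, ∑ _r : n, η ^ 2 := by
          refine Finset.sum_le_sum fun q _ => Finset.sum_le_sum fun r _ => ?_
          have := hE r q
          rw [← sq, ← sq_abs]
          exact pow_le_pow_left₀ (abs_nonneg _) this 2
      _ = _ := by simp [Finset.card_univ]; ring
  rw [e0]
  have := mul_le_mul_of_nonneg_left s3 (by positivity : 0 ≤ 2 * ρ)
  linarith

/-! scalar facts -/

theorem rcoth_eq {x : ℝ} (hx : 0 < x) : rcoth x = 1 + 2 / (Real.exp (2 * x) - 1) := by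
  have h1 : 1 < Real.exp (2 * x) := Real.one_lt_exp_iff.2 (by linarith)
  have h2 : Real.exp (2 * x) = Real.exp x * Real.exp x := by rw [← Real.exp_add]; ring_nf
  have h3 : 0 < Real.exp x := Real.exp_pos x
  rw [rcoth, Real.cosh_eq, Real.sinh_eq, Real.exp_neg]
  rw [h2] at h1 ⊢
  have h4 : Real.exp x * Real.exp x - 1 ≠ 0 := by linarith
  have h5 : Real.exp x - (Real.exp x)⁻¹ ≠ 0 := by
    intro h
    apply h4
    field_simp at h
    nlinarith
  have h6 : Real.exp x ^ 2 - 1 ≠ 0 := by rw [sq]; exact h4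
  field_simp
  ring

theorem rcoth_gt {x : ℝ} (hx : 0 < x) : 1 < rcoth x := by
  rw [rcoth_eq hx]
  have h1 : 1 < Real.exp (2 * x) := Real.one_lt_exp_iff.2 (by linarith)
  have : 0 < 2 / (Real.exp (2 * x) - 1) := div_pos two_pos (by linarith)
  linarith

theorem rcoth_anti {x y : ℝ} (hx : 0 < x) (hxy : x ≤ y) : rcoth y ≤ rcoth x := by
  rw [rcoth_eq hx, rcoth_eq (hx.trans_le hxy)]
  have h1 : 1 < Real.exp (2 * x) := Real.one_lt_exp_iff.2 (by linarith)
  have h2 : Real.exp (2 * x) ≤ Real.exp (2 * y) := Real.exp_le_exp.2 (by linarith)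
  have := div_le_div_of_nonneg_left (zero_le_two (α := ℝ)) (by linarith : 0 < Real.exp (2 * x) - 1)
    (by linarith : Real.exp (2 * x) - 1 ≤ Real.exp (2 * y) - 1)
  linarith

noncomputable def hh (c s : ℝ) : ℝ := (Real.log (c + s) - Real.log (c - s)) / 2

theorem hh_zero (c : ℝ) : hh c 0 = 0 := by simp [hh]

theorem hh_one {x : ℝ} (hx : 0 < x) : hh (rcoth x) 1 = x := by
  have h1 : 1 < Real.exp (2 * x) := Real.one_lt_exp_iff.2 (by linarith)
  have hg := rcoth_gt hx
  rw [hh, ← Real.log_div (by linarith) (by linarith)]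
  have : (rcoth x + 1) / (rcoth x - 1) = Real.exp (2 * x) := by
    rw [rcoth_eq hx]
    have : Real.exp (2 * x) - 1 ≠ 0 := by linarith
    field_simp
    ring
  rw [this, Real.log_exp]; ring

theorem hh_deriv {c s : ℝ} (h1 : 0 < c + s) (h2 : 0 < c - s) :
    HasDerivAt (hh c) (c / (c ^ 2 - s ^ 2)) s := by
  have a : HasDerivAt (fun s => c + s) 1 s := (hasDerivAt_id s).const_add c
  have b : HasDerivAt (fun s => c - s) (-1) s := (hasDerivAt_id s).const_sub c
  have := ((a.log h1.ne').sub (b.log h2.ne')).div_const 2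
  refine HasDerivAt.congr_deriv this ?_
  have : c ^ 2 - s ^ 2 ≠ 0 := by
    have := mul_pos h1 h2
    nlinarith
  have h1' := h1.ne'
  have h2' := h2.ne'
  field_simp
  ring

theorem sandwich_apply {m : ℕ} (T : Matrix (Idx m) (Idx m) ℝ) (a : Fin m → ℝ) (p q : Idx m) :
    (Tᵀ * pairDiag a * T) p q = ∑ r, T r p * a r.1 * T r q := by
  simp [Matrix.mul_apply, pairDiag, Matrix.diagonal_apply]

theorem H_deriv {m : ℕ} (T X : Matrix (Idx m) (Idx m) ℝ) (c : Fin m → ℝ) (s : ℝ)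
    (h1 : ∀ i, 0 < c i + s) (h2 : ∀ i, 0 < c i - s) :
    HasDerivAt (fun s => ∑ p, ∑ q, (Tᵀ * pairDiag (fun i => hh (c i) s) * T) p q * X p q)
      (∑ p, ∑ q, (Tᵀ * pairDiag (fun i => c i / (c i ^ 2 - s ^ 2)) * T) p q * X p q) s := by
  simp only [sandwich_apply]
  refine HasDerivAt.fun_sum fun p _ => HasDerivAt.fun_sum fun q _ => HasDerivAt.mul_const ?_ _
  refine HasDerivAt.fun_sum fun r _ => HasDerivAt.mul_const ?_ _
  exact (hh_deriv (h1 r.1) (h2 r.1)).const_mul _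

/-- From a pointwise bound on the resolvent difference to a bound on `Ĥ - H`. -/
theorem mvt {m : ℕ} (S Sh X : Matrix (Idx m) (Idx m) ℝ) (d dh : Fin m → ℝ)
    (hd : ∀ i, 0 < d i) (hdh : ∀ i, 0 < dh i) (B : ℝ)
    (hB : ∀ s, 0 ≤ s → s ≤ 1 → ∑ p, ∑ q,
      (GG Sh (fun i => rcoth (dh i)) s - GG S (fun i => rcoth (d i)) s) p q * X p q ≤ B) :
    ∑ p, ∑ q, ((Sh⁻¹)ᵀ * pairDiag dh * Sh⁻¹ - (S⁻¹)ᵀ * pairDiag d * S⁻¹) p q * X p q ≤ B := by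
  have D : ∀ s ∈ Set.Icc (0:ℝ) 1, HasDerivAt
      (fun s => ∑ p, ∑ q, ((Sh⁻¹)ᵀ * pairDiag (fun i => hh (rcoth (dh i)) s) * Sh⁻¹) p q * X p q
        - ∑ p, ∑ q, ((S⁻¹)ᵀ * pairDiag (fun i => hh (rcoth (d i)) s) * S⁻¹) p q * X p q)
      (∑ p, ∑ q,
        (GG Sh (fun i => rcoth (dh i)) s - GG S (fun i => rcoth (d i)) s) p q * X p q) s := by
    intro s hs
    have := (H_deriv Sh⁻¹ X (fun i => rcoth (dh i)) s
      (fun i => by linarith [rcoth_gt (hdh i), hs.1]) (fun i => by linarith [rcoth_gt (hdh i), hs.2])).sub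
      (H_deriv S⁻¹ X (fun i => rcoth (d i)) s
      (fun i => by linarith [rcoth_gt (hd i), hs.1]) (fun i => by linarith [rcoth_gt (hd i), hs.2]))
    refine HasDerivAt.congr_deriv this ?_
    simp only [GG, Matrix.sub_apply, sub_mul, Finset.sum_sub_distrib]
  obtain ⟨s, hs, hs'⟩ := exists_hasDerivAt_eq_slope _ _ zero_lt_one
    (fun s hs => (D s hs).continuousAt.continuousWithinAt) (fun s hs => D s (Set.Ioo_subset_Icc_self hs))
  have := hB s hs.1.le hs.2.le
  rw [hs'] at this
  simp only [hh_zero, hh_one (hd _), hh_one (hdh _), sandwich_apply] at this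
  simp only [Matrix.sub_apply, sub_mul, Finset.sum_sub_distrib, sandwich_apply]
  simpa using this

end St18

set_option maxHeartbeats 2000000 in
/-- The deterministic inequality underlying trace-distance learning:
if the covariance matrices and mean vectors are entrywise `ε`-close and
`2‖V - V̂‖∞ < e^{-2 d_max}/((1 - e^{-2 d_max})·‖S‖∞²)`, then
`Σ_{i,j} [(Ĥ_{i,j} - H_{i,j})(V_{i,j} - V̂_{i,j}) + 2(t_i - t̂_i)(t_j - t̂_j)(H_{i,j} + Ĥ_{i,j})]
  ≤ m²ε²(12m(e^{2 d_max} - 1)²‖S‖∞⁴ + 16‖S‖∞²·d_max)`. -/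
theorem statement18 {m : ℕ} (hm : 0 < m)
    (S Shat : Matrix (Idx m) (Idx m) ℝ)
    (hS : S * Omega m * Sᵀ = Omega m) (hShat : Shat * Omega m * Shatᵀ = Omega m)
    (d dhat : Fin m → ℝ) (hd : ∀ i, 0 < d i) (hdhat : ∀ i, 0 < dhat i)
    (H Hhat : Matrix (Idx m) (Idx m) ℝ)
    (hH : H = (S⁻¹)ᵀ * pairDiag d * S⁻¹)
    (hHhat : Hhat = (Shat⁻¹)ᵀ * pairDiag dhat * Shat⁻¹)
    (V Vhat : Matrix (Idx m) (Idx m) ℝ)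
    (hV : V = (1/2 : ℝ) • (S * pairDiag (fun i => rcoth (d i)) * Sᵀ))
    (hVhat : Vhat = (1/2 : ℝ) • (Shat * pairDiag (fun i => rcoth (dhat i)) * Shatᵀ))
    (dmax : ℝ) (hdmax_le : ∀ i, d i ≤ dmax) (hdmax_mem : ∃ i, d i = dmax)
    (t that : Idx m → ℝ)
    (ε : ℝ) (hε : ε ∈ Set.Ioo (0 : ℝ) 1)
    (hVclose : ∀ p q : Idx m, |V p q - Vhat p q| ≤ ε)
    (htclose : ∀ p : Idx m, |t p - that p| ≤ ε)
    (hVV : 2 * spNorm (V - Vhat) <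
      Real.exp (-2 * dmax) / ((1 - Real.exp (-2 * dmax)) * spNorm S ^ 2)) :
    ∑ p : Idx m, ∑ q : Idx m,
        ((Hhat p q - H p q) * (V p q - Vhat p q) +
          2 * (t p - that p) * (t q - that q) * (H p q + Hhat p q)) ≤
      (m : ℝ) ^ 2 * ε ^ 2 *
        (12 * m * (Real.exp (2 * dmax) - 1) ^ 2 * spNorm S ^ 4 +
          16 * spNorm S ^ 2 * dmax) := by
  obtain ⟨i0, hi0⟩ := hdmax_mem
  have hdm : 0 < dmax := hi0 ▸ hd i0
  have hε0 := hε.1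
  have hε1 := hε.2
  set σ := spNorm S with hσdef
  have hm1 : (1 : ℝ) ≤ m := by exact_mod_cast hm
  have hσ : 0 < σ := by
    rcases (St18.spNorm_nonneg S).eq_or_lt with h | h
    · exfalso
      have h' : σ = 0 := h.symm
      rw [h'] at hVV
      have := St18.spNorm_nonneg (V - Vhat)
      simp at hVV
      linarith
    · exact h
  set X := Real.exp (2 * dmax) - 1 with hX
  have hXpos : 0 < X := by
    have : 1 < Real.exp (2 * dmax) := Real.one_lt_exp_iff.2 (by linarith)
    linarith
  set c0 := rcoth dmax with hc0
  have hc0' : c0 - 1 = 2 / X := by rw [hc0, St18.rcoth_eq hdm]; ring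
  set k := (c0 - 1) / σ ^ 2 with hk
  have hk' : k = 2 / (X * σ ^ 2) := by rw [hk, hc0']; field_simp
  have hkpos : 0 < k := by rw [hk']; positivity
  have hVV' : 2 * spNorm (V - Vhat) ≤ k / 2 := by
    refine hVV.le.trans (le_of_eq ?_)
    have e : Real.exp (-2 * dmax) = 1 / (X + 1) := by
      rw [hX, neg_mul, Real.exp_neg]; simp
    rw [e, hk']
    have : X + 1 ≠ 0 := by linarith
    have h3 : 1 - 1 / (X + 1) = X / (X + 1) := by field_simp; ring
    rw [h3]
    field_simp
  set c : Fin m → ℝ := fun i => rcoth (d i) with hc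
  set ch : Fin m → ℝ := fun i => rcoth (dhat i) with hch
  set W := S * pairDiag c * Sᵀ with hW
  set Wh := Shat * pairDiag ch * Shatᵀ with hWh
  set E := W - Wh with hE
  have hEV : E = (2 : ℝ) • (V - Vhat) := by
    rw [hV, hVhat, ← smul_sub, smul_smul]; norm_num
    rfl
  have hEb : ∀ p q, |E p q| ≤ 2 * ε := by
    intro p q
    rw [hEV, Matrix.smul_apply, Matrix.sub_apply, smul_eq_mul, abs_mul, abs_two]
    linarith [hVclose p q]
  have hEs : Eᵀ = E := by
    rw [hE, Matrix.transpose_sub, hW, hWh, St18.W_transpose, St18.W_transpose]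
  have hco : ∀ s, 0 ≤ s → s ≤ 1 → ∀ u v : Idx m → ℝ, k * (u ⬝ᵥ u + v ⬝ᵥ v) ≤
      u ⬝ᵥ (W *ᵥ u) + v ⬝ᵥ (W *ᵥ v) + 2 * s * (u ⬝ᵥ (Omega m *ᵥ v)) := fun s h0 h1 u v =>
    St18.coer hS hσ c c0 s (St18.rcoth_gt hdm) (fun i => St18.rcoth_anti (hd i) (hdmax_le i)) h0 h1 u v
  have hcoh : ∀ s, 0 ≤ s → s ≤ 1 → ∀ u v : Idx m → ℝ, k / 2 * (u ⬝ᵥ u + v ⬝ᵥ v) ≤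
      u ⬝ᵥ (Wh *ᵥ u) + v ⬝ᵥ (Wh *ᵥ v) + 2 * s * (u ⬝ᵥ (Omega m *ᵥ v)) := by
    intro s h0 h1 u v
    have a := hco s h0 h1 u v
    have b : ∀ w : Idx m → ℝ, w ⬝ᵥ (W *ᵥ w) - w ⬝ᵥ (Wh *ᵥ w) ≤ k / 2 * (w ⬝ᵥ w) := by
      intro w
      rw [← dotProduct_sub, ← Matrix.sub_mulVec, ← hE, hEV, Matrix.smul_mulVec, dotProduct_smul,
        smul_eq_mul]
      have h1 := St18.spNorm_quad (V - Vhat) w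
      have h2 := mul_le_mul_of_nonneg_right hVV' (St18.dot_self_nonneg' w)
      linarith
    linarith [b u, b v]
  set ρ := 1 / k ^ 2 with hρ
  have hρ0 : 0 ≤ ρ := by positivity
  have hρ' : ρ = X ^ 2 * σ ^ 4 / 4 := by rw [hρ, hk']; field_simp; norm_num
  set τ : Idx m → ℝ := fun p => t p - that p with hτ
  have hcard : (Fintype.card (Idx m) : ℝ) = 2 * m := by simp; ring
  have hττ : τ ⬝ᵥ τ ≤ 2 * m * ε ^ 2 := by
    calc τ ⬝ᵥ τ ≤ ∑ _p : Idx m, ε ^ 2 := by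
          refine Finset.sum_le_sum fun p _ => ?_
          rw [← sq, ← sq_abs]
          exact pow_le_pow_left₀ (abs_nonneg _) (htclose p) 2
      _ = _ := by rw [Finset.sum_const, Finset.card_univ, nsmul_eq_mul, hcard]
  have hττ0 := St18.dot_self_nonneg' τ
  have hquad : ∀ A : Matrix (Idx m) (Idx m) ℝ, ∑ p, ∑ q, A p q * (τ p * τ q) = τ ⬝ᵥ (A *ᵥ τ) := by
    intro A
    simp only [dotProduct, Matrix.mulVec, Finset.mul_sum]
    refine Finset.sum_congr rfl fun p _ => Finset.sum_congr rfl fun q _ => ?_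
    ring
  -- the pointwise bound
  have hpw : ∀ s, 0 ≤ s → s ≤ 1 → ∑ p, ∑ q,
      (St18.GG Shat ch s - St18.GG S c s) p q * (E p q / 2 + 2 * (τ p * τ q)) ≤
        48 * m ^ 2 * ε ^ 2 * ρ := by
    intro s h0 h1
    have hne : ∀ x : ℝ, 1 < x → x ^ 2 - s ^ 2 ≠ 0 := by
      intro x hx
      have : 0 < x ^ 2 - s ^ 2 := by nlinarith
      exact this.ne'
    have r1 := St18.res1 hS c s (fun i => hne _ (St18.rcoth_gt (hd i)))
    have r2 := St18.res2 hS c s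
    have r1h := St18.res1 hShat ch s (fun i => hne _ (St18.rcoth_gt (hdhat i)))
    have r2h := St18.res2 hShat ch s
    have r1h' := St18.res1' hShat ch s (fun i => hne _ (St18.rcoth_gt (hdhat i)))
    have r2h' := St18.res2' hShat ch s
    have hdiff := St18.res_diff _ _ _ _ _ _ _ s r1 r2 r1h' r2h'
    have b1 : ∀ x : Idx m → ℝ, (St18.GG S c s *ᵥ x) ⬝ᵥ (St18.GG S c s *ᵥ x) +
        (St18.KK S c s *ᵥ x) ⬝ᵥ (St18.KK S c s *ᵥ x) ≤ ρ * (x ⬝ᵥ x) := by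
      intro x
      have := St18.res_bound _ _ _ _ s k St18.Omega_transpose hkpos r1 r2 (hco s h0 h1) x
      rw [hρ, div_mul_eq_mul_div, one_mul, le_div_iff₀ (by positivity)]
      linarith
    have b2 : ∀ x : Idx m → ℝ, (St18.GG Shat ch s *ᵥ x) ⬝ᵥ (St18.GG Shat ch s *ᵥ x) +
        (St18.KK Shat ch s *ᵥ x) ⬝ᵥ (St18.KK Shat ch s *ᵥ x) ≤ 4 * ρ * (x ⬝ᵥ x) := by
      intro x
      have := St18.res_bound _ _ _ _ s (k / 2) St18.Omega_transpose (half_pos hkpos) r1h r2h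
        (hcoh s h0 h1) x
      rw [hρ, mul_assoc, div_mul_eq_mul_div, one_mul, ← mul_div_assoc, le_div_iff₀ (by positivity)]
      linarith
    have q1 := St18.pw_trace _ _ _ _ E (2 * ε) ρ hρ0 hEb hEs hdiff b1 b2
    have q2 := St18.pw_quad _ _ _ _ E (2 * ε) ρ (by linarith) hEb (St18.GG_transpose _ _ _)
      (St18.KK_transpose _ _ _) hdiff b1 b2 τ
    rw [hcard] at q1 q2
    rw [← hquad] at q2
    have split : ∑ p, ∑ q,
        (St18.GG Shat ch s - St18.GG S c s) p q * (E p q / 2 + 2 * (τ p * τ q)) =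
        (∑ p, ∑ q, (St18.GG Shat ch s - St18.GG S c s) p q * E p q) / 2 +
        2 * ∑ p, ∑ q, (St18.GG Shat ch s - St18.GG S c s) p q * (τ p * τ q) := by
      simp only [Finset.mul_sum, Finset.sum_div, ← Finset.sum_add_distrib]
      refine Finset.sum_congr rfl fun p _ => Finset.sum_congr rfl fun q _ => ?_
      ring
    rw [split]
    have z1 : 2 * ε * (2 * m) * (2 * ρ * (τ ⬝ᵥ τ)) ≤ 2 * ε * (2 * m) * (2 * ρ * (2 * m * ε ^ 2)) := by
      gcongr
    have z2 : 2 * ε * (2 * m) * (2 * ρ * (2 * m * ε ^ 2)) ≤ 16 * m ^ 2 * ε ^ 2 * ρ := by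
      have : 0 ≤ 16 * (m : ℝ) ^ 2 * ε ^ 2 * ρ := by positivity
      have h2 := mul_nonneg (sub_nonneg.2 hε1.le) this
      linarith
    have z3 : 2 * ρ * ((2 * (m : ℝ)) ^ 2 * (2 * ε) ^ 2) = 32 * m ^ 2 * ε ^ 2 * ρ := by ring
    linarith
  have hmain := St18.mvt S Shat (fun p q => E p q / 2 + 2 * (τ p * τ q)) d dhat hd hdhat _ hpw
  rw [← hH, ← hHhat] at hmain
  -- the quadratic form of H
  have hHq : τ ⬝ᵥ (H *ᵥ τ) ≤ dmax * (σ ^ 2 * (2 * m * ε ^ 2)) := by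
    have e : τ ⬝ᵥ (H *ᵥ τ) = (S⁻¹ *ᵥ τ) ⬝ᵥ (pairDiag d *ᵥ (S⁻¹ *ᵥ τ)) := by
      rw [hH, ← Matrix.mulVec_mulVec, ← Matrix.mulVec_mulVec, Matrix.dotProduct_mulVec,
        ← Matrix.mulVec_transpose, Matrix.transpose_transpose]
    have e2 : (S⁻¹ *ᵥ τ) ⬝ᵥ (pairDiag d *ᵥ (S⁻¹ *ᵥ τ)) ≤
        dmax * ((S⁻¹ *ᵥ τ) ⬝ᵥ (S⁻¹ *ᵥ τ)) := by
      simp only [pairDiag, dotProduct, Matrix.mulVec_diagonal, Finset.mul_sum]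
      refine Finset.sum_le_sum fun p _ => ?_
      nlinarith [hdmax_le p.1, mul_self_nonneg ((S⁻¹ *ᵥ τ) p)]
    rw [e]
    refine e2.trans (mul_le_mul_of_nonneg_left ?_ hdm.le)
    refine (St18.symp_bound' hS τ).trans ?_
    gcongr
  have hfin : ∑ p : Idx m, ∑ q : Idx m,
        ((Hhat p q - H p q) * (V p q - Vhat p q) +
          2 * (t p - that p) * (t q - that q) * (H p q + Hhat p q)) =
      ∑ p, ∑ q, (Hhat - H) p q * (E p q / 2 + 2 * (τ p * τ q)) + 4 * (τ ⬝ᵥ (H *ᵥ τ)) := by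
    rw [← hquad]
    simp only [Finset.mul_sum, ← Finset.sum_add_distrib]
    refine Finset.sum_congr rfl fun p _ => Finset.sum_congr rfl fun q _ => ?_
    rw [hEV, Matrix.smul_apply, Matrix.sub_apply, Matrix.sub_apply, smul_eq_mul, hτ]
    ring
  rw [hfin]
  have y1 : 48 * (m : ℝ) ^ 2 * ε ^ 2 * ρ ≤ m ^ 2 * ε ^ 2 * (12 * m * X ^ 2 * σ ^ 4) := by
    rw [hρ']
    have : 0 ≤ (m : ℝ) ^ 2 * ε ^ 2 * X ^ 2 * σ ^ 4 := by positivity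
    have h2 := mul_nonneg (sub_nonneg.2 hm1) this
    linarith
  have y2 : 4 * (dmax * (σ ^ 2 * (2 * m * ε ^ 2))) ≤ m ^ 2 * ε ^ 2 * (16 * σ ^ 2 * dmax) := by
    have : 0 ≤ (m : ℝ) * ε ^ 2 * σ ^ 2 * dmax := by positivity
    have h2 := mul_nonneg (sub_nonneg.2 hm1) this
    linarith
  linarith
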